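/- arXiv:2205.01599 — 6 statements merged into one kernel-verified Lean document; each statement's English description precedes it below -/
import Mathlib

section
/- Let (X,d) be a metric space, (P,ρ) a separable metric space with a countable dense subset Q, Z := X × P with a product metric, and l ≥ 1 an integer. Suppose G : Z → (subsets of X^l) satisfies: for every z = (x,p) ∈ Z the set G(z) is nonempty, and for any u ∈ G(z) and any sequence (xₙ) in X converging to x there is a sequence (pₙ) in Q converging to p such that, with zₙ = (xₙ,pₙ), eventually u ∈ G(zₙ) ⊆ G(z). Suppose Φ : Z × X^l → ℝ ∪ {+∞} satisfies, for every z ∈ Z: (A2.1) for every u ∈ G(z), if zₙ → z then Φ(zₙ,u) → Φ(z,u); and (A2.2) for every nonempty set A ⊆ X^l intersecting G(z) and every sequence zₙ → z, limsup_n sup{Φ(zₙ,u) : u ∈ A ∩ G(z)} ≤ sup{Φ(z,u) : u ∈ A ∩ G(z)}. Then the family 𝓡 of closed separable subsets Y of X such that for every x ∈ Y and every p ∈ P, writing z = (x,p), one has Y^l ∩ G(z) ≠ ∅ and sup{Φ(z,u) : u ∈ G(z)} = sup{Φ(z,u) : u ∈ Y^l ∩ G(z)}, is a rich family. -/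
open Filter TopologicalSpace Set Metric
open scoped Topology

/-- A family `R` of closed separable subsets of a metric space `X` is *rich* if
(i) every separable subset of `X` is contained in some member of `R` (cofinality), and
(ii) for every increasing sequence of members of `R`, the closure of its union belongs
to `R` (σ-closedness). -/
def IsRichFamily {X : Type*} [MetricSpace X] (R : Set (Set X)) : Prop :=
  (∀ Y ∈ R, IsClosed Y ∧ TopologicalSpace.IsSeparable Y) ∧
  (∀ Y₀ : Set X, TopologicalSpace.IsSeparable Y₀ → ∃ Y ∈ R, Y₀ ⊆ Y) ∧
  (∀ Y : ℕ → Set X, (∀ n, Y n ∈ R) → (∀ n, Y n ⊆ Y (n + 1)) →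
    closure (⋃ n, Y n) ∈ R)

/-- A supremum over a nonempty set of a function with values in `EReal` is attained along a
sequence of elements of the set. -/
theorem exists_seq_biSup_le {α : Type*} {S : Set α} (hS : S.Nonempty) (f : α → EReal) :
    ∃ v : ℕ → α, (∀ n, v n ∈ S) ∧ ⨆ u ∈ S, f u ≤ ⨆ n, f (v n) := by
  obtain ⟨w, -, hlim, hmem⟩ := exists_seq_tendsto_sSup (hS.image f) (OrderTop.bddAbove _)
  choose v hv hvw using hmem
  refine ⟨v, hv, ?_⟩
  rw [← sSup_image]
  refine le_of_tendsto' hlim fun n => ?_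
  rw [← hvw n]
  exact le_iSup (fun n => f (v n)) n

/-- Every countable set is contained in a countable set closed under countably many
operations `F i` with countable set values. -/
theorem exists_countable_superset_closed {X ι : Type*} [Countable ι] (F : X → ι → Set X)
    (hF : ∀ x i, (F x i).Countable) {C : Set X} (hC : C.Countable) :
    ∃ D : Set X, D.Countable ∧ C ⊆ D ∧ ∀ x ∈ D, ∀ i, F x i ⊆ D := by
  let step : Set X → Set X := fun B => ⋃ x ∈ B, ⋃ i, F x i
  refine ⟨⋃ n, step^[n] C, countable_iUnion fun n => ?_,
    subset_iUnion (fun n => step^[n] C) 0, fun x hx i => ?_⟩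
  · induction n with
    | zero => exact hC
    | succ n ih =>
      rw [Function.iterate_succ_apply']
      exact ih.biUnion fun x _ => countable_iUnion (hF x)
  · obtain ⟨n, hn⟩ := mem_iUnion.1 hx
    refine Subset.trans ?_ (subset_iUnion (fun n => step^[n] C) (n + 1))
    simp only [Function.iterate_succ_apply']
    exact (subset_iUnion (F x) i).trans (subset_biUnion_of_mem (u := fun x => ⋃ i, F x i) hn)

/-- If a set `T` of test points meets `G (x, q)` and realizes the supremum of `Φ (x, q)` over it
for all `x` in `D` and `q` in `Q`, then it does so for all `x` in the closure of `D` and all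
parameters. -/
theorem biSup_eq_of_mem_closure {X P E : Type*} [MetricSpace X] [MetricSpace P] {Q : Set P}
    {G : X × P → Set E} {Φ : X × P → E → EReal}
    (hG_ne : ∀ z : X × P, (G z).Nonempty)
    (hA1 : ∀ (x : X) (p : P), ∀ u ∈ G (x, p), ∀ xn : ℕ → X,
      Tendsto xn atTop (𝓝 x) →
        ∃ pn : ℕ → P, (∀ n, pn n ∈ Q) ∧ Tendsto pn atTop (𝓝 p) ∧
          ∀ᶠ n in atTop, u ∈ G (xn n, pn n) ∧ G (xn n, pn n) ⊆ G (x, p))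
    (hA21 : ∀ z : X × P, ∀ u ∈ G z, ∀ zn : ℕ → X × P,
      Tendsto zn atTop (𝓝 z) →
        Tendsto (fun n => Φ (zn n) u) atTop (𝓝 (Φ z u)))
    (hA22 : ∀ z : X × P, ∀ A : Set E, (A ∩ G z).Nonempty →
      ∀ zn : ℕ → X × P, Tendsto zn atTop (𝓝 z) →
        limsup (fun n => ⨆ u ∈ A ∩ G z, Φ (zn n) u) atTop ≤
          ⨆ u ∈ A ∩ G z, Φ z u)
    {D : Set X} {T : Set E}
    (hT : ∀ x ∈ D, ∀ q ∈ Q, (T ∩ G (x, q)).Nonempty ∧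
      ⨆ u ∈ G (x, q), Φ (x, q) u ≤ ⨆ u ∈ T ∩ G (x, q), Φ (x, q) u)
    {x : X} (hx : x ∈ closure D) (p : P) :
    (T ∩ G (x, p)).Nonempty ∧
      ⨆ u ∈ G (x, p), Φ (x, p) u = ⨆ u ∈ T ∩ G (x, p), Φ (x, p) u := by
  obtain ⟨xn, hxn, hxlim⟩ := mem_closure_iff_seq_limit.1 hx
  have hne : (T ∩ G (x, p)).Nonempty := by
    obtain ⟨u, hu⟩ := hG_ne (x, p)
    obtain ⟨pn, hpn, -, hev⟩ := hA1 x p u hu xn hxlim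
    obtain ⟨n, -, hn⟩ := hev.exists
    exact (hT _ (hxn n) _ (hpn n)).1.mono (inter_subset_inter_right _ hn)
  refine ⟨hne, le_antisymm (iSup₂_le fun u hu => ?_) (biSup_mono fun u hu => hu.2)⟩
  obtain ⟨pn, hpn, hplim, hev⟩ := hA1 x p u hu xn hxlim
  have hz : Tendsto (fun n => (xn n, pn n)) atTop (𝓝 (x, p)) := hxlim.prodMk_nhds hplim
  rw [← (hA21 (x, p) u hu _ hz).limsup_eq]
  refine le_trans (limsup_le_limsup ?_) (hA22 (x, p) T hne _ hz)
  filter_upwards [hev] with n hn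
  calc Φ (xn n, pn n) u ≤ ⨆ v ∈ G (xn n, pn n), Φ (xn n, pn n) v :=
        le_biSup (Φ (xn n, pn n)) hn.1
    _ ≤ ⨆ v ∈ T ∩ G (xn n, pn n), Φ (xn n, pn n) v := (hT _ (hxn n) _ (hpn n)).2
    _ ≤ ⨆ v ∈ T ∩ G (x, p), Φ (xn n, pn n) v :=
        biSup_mono fun v hv => ⟨hv.1, hn.2 hv.2⟩

/-- The general separable-reducibility theorem (Theorem 2.1). Here `X^l` is modelled
as `Fin l → X`, `Φ` takes values in `ℝ ∪ {+∞}` (i.e. `EReal` values never equal to `⊥`),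
and suprema are taken in the extended reals. -/
theorem general_separable_reducibility_sup
    {X P : Type*} [MetricSpace X] [MetricSpace P]
    (Q : Set P) (hQcount : Q.Countable) (hQdense : Dense Q)
    (l : ℕ) (hl : 1 ≤ l)
    (G : X × P → Set (Fin l → X))
    (Φ : X × P → (Fin l → X) → EReal)
    (hΦ_ne_bot : ∀ z u, Φ z u ≠ ⊥)
    (hG_ne : ∀ z : X × P, (G z).Nonempty)
    -- (A1.1)
    (hA1 : ∀ (x : X) (p : P), ∀ u ∈ G (x, p), ∀ xn : ℕ → X,
      Tendsto xn atTop (𝓝 x) →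
        ∃ pn : ℕ → P, (∀ n, pn n ∈ Q) ∧ Tendsto pn atTop (𝓝 p) ∧
          ∀ᶠ n in atTop, u ∈ G (xn n, pn n) ∧ G (xn n, pn n) ⊆ G (x, p))
    -- (A2.1)
    (hA21 : ∀ z : X × P, ∀ u ∈ G z, ∀ zn : ℕ → X × P,
      Tendsto zn atTop (𝓝 z) →
        Tendsto (fun n => Φ (zn n) u) atTop (𝓝 (Φ z u)))
    -- (A2.2)
    (hA22 : ∀ z : X × P, ∀ A : Set (Fin l → X), (A ∩ G z).Nonempty →
      ∀ zn : ℕ → X × P, Tendsto zn atTop (𝓝 z) →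
        limsup (fun n => ⨆ u ∈ A ∩ G z, Φ (zn n) u) atTop ≤
          ⨆ u ∈ A ∩ G z, Φ z u) :
    IsRichFamily {Y : Set X | IsClosed Y ∧ TopologicalSpace.IsSeparable Y ∧
      ∀ x ∈ Y, ∀ p : P,
        ({u : Fin l → X | ∀ i, u i ∈ Y} ∩ G (x, p)).Nonempty ∧
        (⨆ u ∈ G (x, p), Φ (x, p) u) =
          ⨆ u ∈ {u : Fin l → X | ∀ i, u i ∈ Y} ∩ G (x, p), Φ (x, p) u} := by
  refine ⟨fun Y hY => ⟨hY.1, hY.2.1⟩, fun Y₀ hY₀ => ?_, fun Y hY _ => ?_⟩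
  · obtain ⟨C, hC, hYC⟩ := hY₀
    have : Countable Q := hQcount.to_subtype
    choose v hvG hvsup using fun z => exists_seq_biSup_le (hG_ne z) (Φ z)
    obtain ⟨D, hD, hCD, hDv⟩ := exists_countable_superset_closed
      (fun x (q : Q) => ⋃ n, range (v (x, (q : P)) n))
      (fun x q => countable_iUnion fun n => countable_range _) hC
    refine ⟨closure D, ⟨isClosed_closure, hD.isSeparable.closure, fun x hx p =>
      biSup_eq_of_mem_closure hG_ne hA1 hA21 hA22 (fun x hx q hq => ?_) hx p⟩,
      hYC.trans (closure_mono hCD)⟩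
    have hmem (n : ℕ) : v (x, q) n ∈ {u : Fin l → X | ∀ i, u i ∈ closure D} ∩ G (x, q) :=
      ⟨fun i => subset_closure (hDv x hx ⟨q, hq⟩ (mem_iUnion.2 ⟨n, mem_range_self i⟩)),
        hvG _ n⟩
    exact ⟨⟨_, hmem 0⟩,
      (hvsup (x, q)).trans (iSup_le fun n => le_biSup (Φ (x, q)) (hmem n))⟩
  · refine ⟨isClosed_closure, (IsSeparable.iUnion fun n => (hY n).2.1).closure, fun x hx p =>
      biSup_eq_of_mem_closure hG_ne hA1 hA21 hA22 (fun x hx q _ => ?_) hx p⟩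
    obtain ⟨n, hn⟩ := mem_iUnion.1 hx
    have hsub : {u : Fin l → X | ∀ i, u i ∈ Y n} ∩ G (x, q) ⊆
        {u : Fin l → X | ∀ i, u i ∈ closure (⋃ n, Y n)} ∩ G (x, q) :=
      inter_subset_inter_left _ fun u hu i => subset_closure (mem_iUnion.2 ⟨n, hu i⟩)
    obtain ⟨hne, hsup⟩ := (hY n).2.2 x hn q
    exact ⟨hne.mono hsub, hsup.le.trans (biSup_mono fun u hu => hsub hu)⟩
end

section
/- Let (X,d) be a metric space, (P,ρ) a separable metric space with a countable dense subset Q, Z := X × P with a product metric, and l ≥ 1 an integer. Suppose G : Z → (subsets of X^l) satisfies: for every z = (x,p) ∈ Z the set G(z) is nonempty, and for any u ∈ G(z) and any sequence (xₙ) in X converging to x there is a sequence (pₙ) in Q converging to p such that, with zₙ = (xₙ,pₙ), eventually u ∈ G(zₙ) ⊆ G(z). Suppose Φ : Z × X^l → ℝ ∪ {−∞} satisfies, for every z ∈ Z: (A2.1) for every u ∈ G(z), if zₙ → z then Φ(zₙ,u) → Φ(z,u); and (A2.2′) for every nonempty set A ⊆ X^l intersecting G(z) and every sequence zₙ → z,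 liminf_n inf{Φ(zₙ,u) : u ∈ A ∩ G(z)} ≥ inf{Φ(z,u) : u ∈ A ∩ G(z)}. Then the family 𝓡 of closed separable subsets Y of X such that for every x ∈ Y and every p ∈ P, writing z = (x,p), one has Y^l ∩ G(z) ≠ ∅ and inf{Φ(z,u) : u ∈ G(z)} = inf{Φ(z,u) : u ∈ Y^l ∩ G(z)}, is a rich family. -/
open Filter TopologicalSpace Set Metric
open scoped Topology

/-- A countable set is contained in a countable set that is stable under a map with countable
set values. -/
lemma exists_countable_superset_forall_subset {X : Type*} {F : X → Set X}
    (hF : ∀ x, (F x).Countable) {C : Set X} (hC : C.Countable) :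
    ∃ D : Set X, C ⊆ D ∧ D.Countable ∧ ∀ x ∈ D, F x ⊆ D := by
  let E : ℕ → Set X := fun n => Nat.rec C (fun _ B => ⋃ x ∈ B, F x) n
  have hE : ∀ n, (E n).Countable := fun n => by
    induction n with
    | zero => exact hC
    | succ n ih => exact ih.biUnion fun x _ => hF x
  refine ⟨⋃ n, E n, subset_iUnion E 0, countable_iUnion hE, fun x hx => ?_⟩
  obtain ⟨n, hn⟩ := mem_iUnion.1 hx
  exact (subset_biUnion_of_mem (u := F) hn).trans (subset_iUnion E (n + 1))

/-- The infimum of a function over a nonempty set is attained along a nonempty countable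
subset. -/
lemma exists_countable_subset_biInf_le {α : Type*} (f : α → EReal) {s : Set α}
    (hs : s.Nonempty) :
    ∃ t ⊆ s, t.Countable ∧ t.Nonempty ∧ ⨅ u ∈ t, f u ≤ ⨅ u ∈ s, f u := by
  obtain ⟨v, -, hv, hvs⟩ := exists_seq_tendsto_sInf (hs.image f) (OrderBot.bddBelow _)
  choose w hws hwv using hvs
  refine ⟨range w, range_subset_iff.2 hws, countable_range w, range_nonempty w, ?_⟩
  rw [← sInf_image (s := s)]
  refine ge_of_tendsto' hv fun n => ?_
  rw [← hwv n]
  exact biInf_le f (mem_range_self n)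

/-- If a set `Y` contains nearly minimizing points of `Φ (x, q)` over `G (x, q)` for all `x` in a
dense subset `D` of `Y` and all `q ∈ Q`, then it does so for all `x ∈ Y` and all parameters. -/
lemma nonempty_inter_and_biInf_eq_of_mem_closure
    {X P : Type*} [MetricSpace X] [MetricSpace P] {Q : Set P} {l : ℕ}
    {G : X × P → Set (Fin l → X)} {Φ : X × P → (Fin l → X) → EReal}
    (hG_ne : ∀ z : X × P, (G z).Nonempty)
    (hA1 : ∀ (x : X) (p : P), ∀ u ∈ G (x, p), ∀ xn : ℕ → X,
      Tendsto xn atTop (𝓝 x) →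
        ∃ pn : ℕ → P, (∀ n, pn n ∈ Q) ∧ Tendsto pn atTop (𝓝 p) ∧
          ∀ᶠ n in atTop, u ∈ G (xn n, pn n) ∧ G (xn n, pn n) ⊆ G (x, p))
    (hA21 : ∀ z : X × P, ∀ u ∈ G z, ∀ zn : ℕ → X × P,
      Tendsto zn atTop (𝓝 z) →
        Tendsto (fun n => Φ (zn n) u) atTop (𝓝 (Φ z u)))
    (hA22' : ∀ z : X × P, ∀ A : Set (Fin l → X), (A ∩ G z).Nonempty →
      ∀ zn : ℕ → X × P, Tendsto zn atTop (𝓝 z) →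
        (⨅ u ∈ A ∩ G z, Φ z u) ≤
          liminf (fun n => ⨅ u ∈ A ∩ G z, Φ (zn n) u) atTop)
    {D : Set X} {A : Set (Fin l → X)}
    (hD : ∀ x ∈ D, ∀ q ∈ Q, (A ∩ G (x, q)).Nonempty ∧
      ⨅ u ∈ A ∩ G (x, q), Φ (x, q) u ≤ ⨅ u ∈ G (x, q), Φ (x, q) u)
    {x : X} (hx : x ∈ closure D) (p : P) :
    (A ∩ G (x, p)).Nonempty ∧
      ⨅ u ∈ G (x, p), Φ (x, p) u = ⨅ u ∈ A ∩ G (x, p), Φ (x, p) u := by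
  obtain ⟨xn, hxD, hxn⟩ := mem_closure_iff_seq_limit.1 hx
  have hne : (A ∩ G (x, p)).Nonempty := by
    obtain ⟨u, hu⟩ := hG_ne (x, p)
    obtain ⟨pn, hpQ, -, hev⟩ := hA1 x p u hu xn hxn
    obtain ⟨n, -, hn⟩ := hev.exists
    exact (hD _ (hxD n) _ (hpQ n)).1.mono (inter_subset_inter_right A hn)
  refine ⟨hne, le_antisymm (biInf_mono fun u hu => hu.2) (le_iInf₂ fun u hu => ?_)⟩
  obtain ⟨pn, hpQ, hpn, hev⟩ := hA1 x p u hu xn hxn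
  have hz : Tendsto (fun n => (xn n, pn n)) atTop (𝓝 (x, p)) := hxn.prodMk_nhds hpn
  rw [← (hA21 _ u hu _ hz).liminf_eq]
  refine (hA22' _ A hne _ hz).trans (liminf_le_liminf ?_)
  filter_upwards [hev] with n ⟨hun, hGn⟩
  calc ⨅ v ∈ A ∩ G (x, p), Φ (xn n, pn n) v
      ≤ ⨅ v ∈ A ∩ G (xn n, pn n), Φ (xn n, pn n) v :=
        biInf_mono fun v hv => ⟨hv.1, hGn hv.2⟩
    _ ≤ ⨅ v ∈ G (xn n, pn n), Φ (xn n, pn n) v := (hD _ (hxD n) _ (hpQ n)).2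
    _ ≤ Φ (xn n, pn n) u := biInf_le _ hun

/-- The dual general separable-reducibility theorem (Theorem 2.3), with infima in place
of suprema. Here `X^l` is modelled as `Fin l → X`, `Φ` takes values in `ℝ ∪ {−∞}`
(i.e. `EReal` values never equal to `⊤`), and infima are taken in the extended reals. -/
theorem general_separable_reducibility_inf
    {X P : Type*} [MetricSpace X] [MetricSpace P]
    (Q : Set P) (hQcount : Q.Countable) (hQdense : Dense Q)
    (l : ℕ) (hl : 1 ≤ l)
    (G : X × P → Set (Fin l → X))
    (Φ : X × P → (Fin l → X) → EReal)
    (hΦ_ne_top : ∀ z u, Φ z u ≠ ⊤)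
    (hG_ne : ∀ z : X × P, (G z).Nonempty)
    -- (A1.1)
    (hA1 : ∀ (x : X) (p : P), ∀ u ∈ G (x, p), ∀ xn : ℕ → X,
      Tendsto xn atTop (𝓝 x) →
        ∃ pn : ℕ → P, (∀ n, pn n ∈ Q) ∧ Tendsto pn atTop (𝓝 p) ∧
          ∀ᶠ n in atTop, u ∈ G (xn n, pn n) ∧ G (xn n, pn n) ⊆ G (x, p))
    -- (A2.1)
    (hA21 : ∀ z : X × P, ∀ u ∈ G z, ∀ zn : ℕ → X × P,
      Tendsto zn atTop (𝓝 z) →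
        Tendsto (fun n => Φ (zn n) u) atTop (𝓝 (Φ z u)))
    -- (A2.2')
    (hA22' : ∀ z : X × P, ∀ A : Set (Fin l → X), (A ∩ G z).Nonempty →
      ∀ zn : ℕ → X × P, Tendsto zn atTop (𝓝 z) →
        (⨅ u ∈ A ∩ G z, Φ z u) ≤
          liminf (fun n => ⨅ u ∈ A ∩ G z, Φ (zn n) u) atTop) :
    IsRichFamily {Y : Set X | IsClosed Y ∧ TopologicalSpace.IsSeparable Y ∧
      ∀ x ∈ Y, ∀ p : P,
        ({u : Fin l → X | ∀ i, u i ∈ Y} ∩ G (x, p)).Nonempty ∧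
        (⨅ u ∈ G (x, p), Φ (x, p) u) =
          ⨅ u ∈ {u : Fin l → X | ∀ i, u i ∈ Y} ∩ G (x, p), Φ (x, p) u} := by
  refine ⟨fun Y hY => ⟨hY.1, hY.2.1⟩, fun Y₀ hY₀ => ?_, fun Y hY _ => ?_⟩
  · obtain ⟨C, hC, hYC⟩ := hY₀
    choose S hSG hSc hSne hSinf using
      fun z : X × P => exists_countable_subset_biInf_le (Φ z) (hG_ne z)
    obtain ⟨D, hCD, hDc, hFD⟩ := exists_countable_superset_forall_subset
      (F := fun x => ⋃ q ∈ Q, ⋃ u ∈ S (x, q), range u)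
      (fun x => hQcount.biUnion fun q _ => (hSc (x, q)).biUnion fun u _ => countable_range u) hC
    refine ⟨closure D, ⟨isClosed_closure, hDc.isSeparable.closure, fun x hx p => ?_⟩,
      hYC.trans (closure_mono hCD)⟩
    refine nonempty_inter_and_biInf_eq_of_mem_closure hG_ne hA1 hA21 hA22'
      (fun y hy q hq => ?_) hx p
    have hS : S (y, q) ⊆ {u : Fin l → X | ∀ i, u i ∈ closure D} ∩ G (y, q) := fun u hu =>
      ⟨fun i => subset_closure (hFD y hy
        (mem_biUnion hq (mem_biUnion hu (mem_range_self i)))), hSG _ hu⟩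
    exact ⟨(hSne _).mono hS, (biInf_mono hS).trans (hSinf _)⟩
  · refine ⟨isClosed_closure, (IsSeparable.iUnion fun n => (hY n).2.1).closure, fun x hx p => ?_⟩
    refine nonempty_inter_and_biInf_eq_of_mem_closure hG_ne hA1 hA21 hA22'
      (fun y hy q _ => ?_) hx p
    obtain ⟨n, hn⟩ := mem_iUnion.1 hy
    obtain ⟨hne, heq⟩ := (hY n).2.2 y hn q
    have hsub : {u : Fin l → X | ∀ i, u i ∈ Y n} ∩ G (y, q) ⊆
        {u : Fin l → X | ∀ i, u i ∈ closure (⋃ n, Y n)} ∩ G (y, q) :=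
      inter_subset_inter_left _ fun u hu i => subset_closure (mem_iUnion_of_mem n (hu i))
    exact ⟨hne.mono hsub, (biInf_mono hsub).trans heq.ge⟩
end

section
/- Let (X,d) be a metric space and f : X → ℝ a function. Then there is a rich family 𝓡 of closed separable subsets of X such that for every Y ∈ 𝓡 and every x ∈ Y one has liminf_{y→x} f(y) = liminf_{Y∋y→x} f(y), where the left-hand liminf is over y in X tending to x and the right-hand liminf is over y in Y tending to x. -/
open Filter TopologicalSpace Set Metric
open scoped Topology

/-- On every ball with rational radius centred in `Y`, every rational value that `f` undercuts is
already undercut at a point of `Y`. -/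
def ReflectsSublevels {X : Type*} [MetricSpace X] (f : X → ℝ) (Y : Set X) : Prop :=
  ∀ x ∈ Y, ∀ r c : ℚ, (∃ y, dist y x < r ∧ f y < c) → ∃ y ∈ Y, dist y x < r ∧ f y < c

theorem ReflectsSublevels.closure {X : Type*} [MetricSpace X] {f : X → ℝ} {D : Set X}
    (hD : ReflectsSublevels f D) : ReflectsSublevels f (closure D) := by
  rintro x hx r c ⟨y, hyx, hyc⟩
  obtain ⟨s, hs, hsr⟩ := exists_rat_btwn hyx
  obtain ⟨z, hzD, hz⟩ := Metric.mem_closure_iff.1 hx (min ((s - dist y x) / 2) ((r - s) / 2))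
    (lt_min (by linarith) (by linarith))
  have hz₁ := hz.trans_le (min_le_left _ _)
  have hz₂ := hz.trans_le (min_le_right _ _)
  obtain ⟨w, hwD, hw, hwc⟩ := hD z hzD ((s + r) / 2) c
    ⟨y, by push_cast; linarith [dist_triangle y x z], hyc⟩
  push_cast at hw
  exact ⟨w, subset_closure hwD, by linarith [dist_triangle w z x, dist_comm x z], hwc⟩

theorem ReflectsSublevels.iUnion {X ι : Type*} [MetricSpace X] {f : X → ℝ} {Y : ι → Set X}
    (hY : ∀ i, ReflectsSublevels f (Y i)) : ReflectsSublevels f (⋃ i, Y i) := by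
  intro x hx r c h
  obtain ⟨i, hi⟩ := mem_iUnion.1 hx
  obtain ⟨y, hy, h'⟩ := hY i x hi r c h
  exact ⟨y, mem_iUnion_of_mem i hy, h'⟩

theorem exists_countable_superset_reflectsSublevels {X : Type*} [MetricSpace X] (f : X → ℝ)
    {C : Set X} (hC : C.Countable) :
    ∃ D : Set X, D.Countable ∧ C ⊆ D ∧ ReflectsSublevels f D := by
  have hg : ∀ (x : X) (p : ℚ × ℚ), ∃ z, (∃ y, dist y x < p.1 ∧ f y < p.2) →
      dist z x < p.1 ∧ f z < p.2 := by
    intro x p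
    by_cases h : ∃ y, dist y x < p.1 ∧ f y < p.2
    · exact h.imp fun y hy _ => hy
    · exact ⟨x, fun h' => absurd h' h⟩
  choose g hg using hg
  let S : ℕ → Set X := fun n => Nat.rec C (fun _ A => ⋃ x ∈ A, range (g x)) n
  have hS : ∀ n, (S n).Countable := by
    intro n
    induction n with
    | zero => exact hC
    | succ n ih => exact ih.biUnion fun x _ => countable_range (g x)
  refine ⟨⋃ n, S n, countable_iUnion hS, subset_iUnion S 0, ?_⟩
  intro x hx r c h
  obtain ⟨n, hn⟩ := mem_iUnion.1 hx
  exact ⟨g x (r, c), mem_iUnion_of_mem (n + 1) (mem_biUnion hn (mem_range_self _)),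
    hg x (r, c) h⟩

theorem ReflectsSublevels.liminf_eq {X : Type*} [MetricSpace X] {f : X → ℝ} {Y : Set X}
    (hY : ReflectsSublevels f Y) {x : X} (hx : x ∈ Y) :
    liminf (fun y => (f y : EReal)) (𝓝 x) = liminf (fun y => (f y : EReal)) (𝓝[Y] x) := by
  apply le_antisymm (liminf_le_liminf_of_le nhdsWithin_le_nhds)
  by_contra! hlt
  obtain ⟨c, hc₁, hc₂⟩ := EReal.lt_iff_exists_rat_btwn.1 hlt
  have hev := eventually_lt_of_lt_liminf hc₂
  have hfr := frequently_lt_of_liminf_lt (by isBoundedDefault) hc₁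
  obtain ⟨ε, hε, hball⟩ := Metric.mem_nhdsWithin_iff.1 hev
  obtain ⟨r, hr₀, hr⟩ := exists_rat_btwn hε
  obtain ⟨y, hyc, hyx⟩ := (hfr.and_eventually (Metric.ball_mem_nhds x hr₀)).exists
  obtain ⟨z, hzY, hzx, hzc⟩ := hY x hx r c ⟨y, hyx, by exact_mod_cast hyc⟩
  have hz : ((c : ℝ) : EReal) < f z := hball ⟨hzx.trans hr, hzY⟩
  exact lt_asymm hzc (by exact_mod_cast hz)

/-- Separable reducibility of lower limits: there is a rich family `R` of closed
separable subsets of `X` such that for every `Y ∈ R` and every `x ∈ Y`,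
`liminf_{y→x} f(y) = liminf_{Y∋y→x} f(y)` (lower limits computed in the extended
reals, over neighborhoods of `x` in `X`, resp. relative neighborhoods in `Y`). -/
theorem separable_reduction_liminf {X : Type*} [MetricSpace X] (f : X → ℝ) :
    ∃ R : Set (Set X), IsRichFamily R ∧
      ∀ Y ∈ R, ∀ x ∈ Y,
        liminf (fun y => (f y : EReal)) (𝓝 x) =
          liminf (fun y => (f y : EReal)) (𝓝[Y] x) := by
  refine ⟨{Y | (IsClosed Y ∧ IsSeparable Y) ∧ ReflectsSublevels f Y},
    ⟨fun Y hY => hY.1, ?_, ?_⟩, fun Y hY x hx => hY.2.liminf_eq hx⟩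
  · rintro Y₀ ⟨C, hC, hYC⟩
    obtain ⟨D, hD, hCD, hrefl⟩ := exists_countable_superset_reflectsSublevels f hC
    exact ⟨closure D, ⟨⟨isClosed_closure, hD.isSeparable.closure⟩, hrefl.closure⟩,
      hYC.trans (closure_mono hCD)⟩
  · intro Y hY _
    exact ⟨⟨isClosed_closure, (IsSeparable.iUnion fun n => (hY n).1.2).closure⟩,
      (ReflectsSublevels.iUnion fun n => (hY n).2).closure⟩
end

section
/- Let (X,d) be a metric space and f : X → ℝ a function. Then there is a rich family 𝓡 of closed separable subsets of X such that for every Y ∈ 𝓡 and every x ∈ Y, the function f satisfies lim_{y→x} f(y) = f(x) (i.e. f is continuous at x as a function on X) if and only if lim_{Y∋y→x} f(y) = f(x) (i.e. the restriction f|_Y is continuous at x as a function on Y). -/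
open Filter TopologicalSpace Set Metric
open scoped Topology

section Saturation

variable {X Z : Type*} [PseudoMetricSpace X] [TopologicalSpace Z]

/-- A set `Y` is saturated for `f` if, in every ball centred at a point of `Y`, each open set of
values which is attained by `f` is already attained on `Y`. -/
def IsSaturatedFor (f : X → Z) (Y : Set X) : Prop :=
  ∀ x ∈ Y, ∀ r : ℝ, ∀ V : Set Z, IsOpen V →
    (ball x r ∩ f ⁻¹' V).Nonempty → (ball x r ∩ f ⁻¹' V ∩ Y).Nonempty

theorem IsSaturatedFor.iUnion {ι : Sort*} {f : X → Z} {Y : ι → Set X}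
    (h : ∀ i, IsSaturatedFor f (Y i)) : IsSaturatedFor f (⋃ i, Y i) := by
  intro x hx r V hV hne
  obtain ⟨i, hi⟩ := mem_iUnion.1 hx
  exact (h i x hi r V hV hne).mono (inter_subset_inter_right _ (subset_iUnion Y i))

theorem IsSaturatedFor.closure {f : X → Z} {Y : Set X} (h : IsSaturatedFor f Y) :
    IsSaturatedFor f (closure Y) := by
  rintro x hx r V hV ⟨y, hy, hyV⟩
  rw [mem_ball] at hy
  obtain ⟨z, hz, hxz⟩ := Metric.mem_closure_iff.1 hx ((r - dist y x) / 2) (by linarith)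
  have hyz : y ∈ ball z (r - dist x z) := by
    rw [mem_ball]
    linarith [dist_triangle y x z]
  obtain ⟨w, ⟨hw, hwV⟩, hwY⟩ := h z hz _ V hV ⟨y, hyz, hyV⟩
  refine ⟨w, ⟨?_, hwV⟩, subset_closure hwY⟩
  rw [mem_ball] at hw ⊢
  linarith [dist_triangle w z x, dist_comm x z]

theorem exists_countable_inter_ball_preimage_nonempty [SecondCountableTopology Z]
    (f : X → Z) (z : X) :
    ∃ S : Set X, S.Countable ∧ ∀ r : ℝ, ∀ V : Set Z, IsOpen V →
      (ball z r ∩ f ⁻¹' V).Nonempty → (ball z r ∩ f ⁻¹' V ∩ S).Nonempty := by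
  let g : X → ℝ × Z := fun y ↦ (dist y z, f y)
  let t : TopologicalSpace X := TopologicalSpace.induced g inferInstance
  have : @SecondCountableTopology X t := secondCountableTopology_induced X (ℝ × Z) g
  obtain ⟨S, hS, hd⟩ := @TopologicalSpace.exists_countable_dense X t inferInstance
  refine ⟨S, hS, fun r V hV hne ↦ ?_⟩
  exact @Dense.inter_open_nonempty X t S hd _ ⟨Iio r ×ˢ V, isOpen_Iio.prod hV, rfl⟩ hne

theorem exists_countable_isSaturatedFor_superset [SecondCountableTopology Z]
    (f : X → Z) {C : Set X} (hC : C.Countable) :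
    ∃ D : Set X, D.Countable ∧ C ⊆ D ∧ IsSaturatedFor f D := by
  choose S hS hSf using exists_countable_inter_ball_preimage_nonempty f
  let D : ℕ → Set X := fun n ↦ Nat.rec C (fun _ A ↦ ⋃ z ∈ A, S z) n
  have hD : ∀ n, (D n).Countable := by
    intro n
    induction n with
    | zero => exact hC
    | succ n ih => exact ih.biUnion fun z _ ↦ hS z
  refine ⟨⋃ n, D n, countable_iUnion hD, subset_iUnion D 0, fun x hx r V hV hne ↦ ?_⟩
  obtain ⟨n, hn⟩ := mem_iUnion.1 hx
  have hsub : S x ⊆ D (n + 1) := subset_biUnion_of_mem (u := S) hn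
  exact (hSf x r V hV hne).mono
    (inter_subset_inter_right _ (hsub.trans (subset_iUnion D (n + 1))))

theorem IsSaturatedFor.continuousAt [RegularSpace Z] {f : X → Z} {Y : Set X}
    (h : IsSaturatedFor f Y) {x : X} (hx : x ∈ Y) (hf : ContinuousWithinAt f Y x) :
    ContinuousAt f x := by
  refine (closed_nhds_basis (f x)).tendsto_right_iff.2 fun F ⟨hF, hFc⟩ ↦ ?_
  obtain ⟨r, hr, hrF⟩ := Metric.mem_nhdsWithin_iff.1 (hf hF)
  filter_upwards [ball_mem_nhds x hr] with y hy
  by_contra hyF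
  obtain ⟨w, ⟨hw, hwF⟩, hwY⟩ := h x hx r Fᶜ hFc.isOpen_compl ⟨y, hy, hyF⟩
  exact hwF (hrF ⟨hw, hwY⟩)

end Saturation

/-- Separable reducibility of continuity: there is a rich family `R` of closed
separable subsets of `X` such that for every `Y ∈ R` and every `x ∈ Y`, the function
`f` is continuous at `x` (as a function on `X`) if and only if its restriction to
`Y` is continuous at `x` (as a function on `Y`). -/
theorem separable_reduction_continuity {X : Type*} [MetricSpace X] (f : X → ℝ) :
    ∃ R : Set (Set X), IsRichFamily R ∧
      ∀ Y ∈ R, ∀ x ∈ Y,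
        (ContinuousAt f x ↔ ContinuousWithinAt f Y x) := by
  refine ⟨{Y | (IsClosed Y ∧ IsSeparable Y) ∧ IsSaturatedFor f Y},
    ⟨fun Y hY ↦ hY.1, ?_, ?_⟩, fun Y hY x hx ↦
      ⟨fun h ↦ h.continuousWithinAt, hY.2.continuousAt hx⟩⟩
  · rintro Y₀ ⟨C, hC, hYC⟩
    obtain ⟨D, hD, hCD, hDf⟩ := exists_countable_isSaturatedFor_superset f hC
    exact ⟨closure D, ⟨⟨isClosed_closure, hD.isSeparable.closure⟩, hDf.closure⟩,
      hYC.trans (closure_mono hCD)⟩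
  · intro Y hY _
    exact ⟨⟨isClosed_closure, (IsSeparable.iUnion fun n ↦ (hY n).1.2).closure⟩,
      (IsSaturatedFor.iUnion fun n ↦ (hY n).2).closure⟩
end

section
/- Let (X,d) be a metric space and f : X → ℝ a function. Then there is a rich family 𝓡 of closed separable subsets of X such that for every Y ∈ 𝓡, every x ∈ Y and every r > 0 one has sup{ |f(u₁) − f(u₂)| / d(u₁,u₂) : u₁ ≠ u₂, u₁,u₂ ∈ B(x,r) } = sup{ |f(u₁) − f(u₂)| / d(u₁,u₂) : u₁ ≠ u₂, u₁,u₂ ∈ Y ∩ B(x,r) }, where the suprema are taken in the extended reals. -/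
open Filter TopologicalSpace Set Metric
open scoped Topology

/-- The absolute difference quotient of `f` at a pair of points. -/
noncomputable def absDiffQuotient {X : Type*} [MetricSpace X] (f : X → ℝ) (u : X × X) : ℝ :=
  |f u.1 - f u.2| / dist u.1 u.2

/-- Some pair of distinct points of `S` has absolute difference quotient greater than `a`. -/
def HasDiffQuotientAbove {X : Type*} [MetricSpace X] (f : X → ℝ) (S : Set X) (a : ℝ) : Prop :=
  ∃ u : X × X, (u.1 ≠ u.2 ∧ u.1 ∈ S ∧ u.2 ∈ S) ∧ a < absDiffQuotient f u

/-- Difference quotients on balls centred in `S` are approximated from below within `S`. -/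
def CapturesDiffQuotients {X : Type*} [MetricSpace X] (f : X → ℝ) (S : Set X) : Prop :=
  ∀ x ∈ S, ∀ r a : ℝ, HasDiffQuotientAbove f (ball x r) a → HasDiffQuotientAbove f (S ∩ ball x r) a

theorem HasDiffQuotientAbove.mono {X : Type*} [MetricSpace X] {f : X → ℝ} {S T : Set X} {a b : ℝ}
    (h : HasDiffQuotientAbove f S a) (hST : S ⊆ T) (hba : b ≤ a) : HasDiffQuotientAbove f T b := by
  obtain ⟨u, ⟨hne, h1, h2⟩, hu⟩ := h
  exact ⟨u, ⟨hne, hST h1, hST h2⟩, hba.trans_lt hu⟩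

/-- It suffices to capture difference quotients for rational radii and levels on a dense set. -/
theorem capturesDiffQuotients_closure {X : Type*} [MetricSpace X] {f : X → ℝ} {S : Set X}
    (h : ∀ x ∈ S, ∀ q b : ℚ, HasDiffQuotientAbove f (ball x q) b →
      HasDiffQuotientAbove f (S ∩ ball x q) b) :
    CapturesDiffQuotients f (closure S) := by
  rintro x hx r a ⟨u, ⟨hne, h1, h2⟩, hu⟩
  rw [mem_ball] at h1 h2
  obtain ⟨s, hs, hsr⟩ := exists_between (max_lt h1 h2)
  obtain ⟨hs1, hs2⟩ := max_lt_iff.1 hs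
  obtain ⟨y, hyS, hxy⟩ := Metric.mem_closure_iff.1 hx ((r - s) / 2) (by linarith)
  obtain ⟨q, hq1, hq2⟩ := exists_rat_btwn (show s + dist x y < r - dist x y by linarith)
  obtain ⟨b, hab, hbu⟩ := exists_rat_btwn hu
  refine (h y hyS q b ⟨u, ⟨hne, ?_, ?_⟩, hbu⟩).mono
    (inter_subset_inter subset_closure (ball_subset_ball' ?_)) hab.le
  · rw [mem_ball]
    linarith [dist_triangle u.1 x y]
  · rw [mem_ball]
    linarith [dist_triangle u.2 x y]
  · rw [dist_comm]
    linarith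

/-- A countable set is contained in a countable set closed under countably many self-maps. -/
theorem exists_countable_superset_mapsTo {X ι : Type*} [Countable ι] (g : ι → X → X) {C : Set X}
    (hC : C.Countable) : ∃ S, C ⊆ S ∧ S.Countable ∧ ∀ i, MapsTo (g i) S S := by
  have := hC.to_subtype
  refine ⟨range fun p : List ι × C => p.1.foldr g p.2, fun c hc => ⟨([], ⟨c, hc⟩), rfl⟩,
    countable_range _, ?_⟩
  rintro i _ ⟨⟨l, c⟩, rfl⟩
  exact ⟨(i :: l, c), rfl⟩

theorem exists_separable_capturesDiffQuotients {X : Type*} [MetricSpace X] (f : X → ℝ)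
    {Y₀ : Set X} (hY₀ : IsSeparable Y₀) :
    ∃ Y, (IsClosed Y ∧ IsSeparable Y) ∧ CapturesDiffQuotients f Y ∧ Y₀ ⊆ Y := by
  obtain ⟨C, hC, hYC⟩ := hY₀
  have hchoice (x : X) (q b : ℚ) : ∃ u : X × X, HasDiffQuotientAbove f (ball x q) b →
      (u.1 ≠ u.2 ∧ u.1 ∈ ball x q ∧ u.2 ∈ ball x q) ∧ b < absDiffQuotient f u := by
    by_cases h : HasDiffQuotientAbove f (ball x q) b
    · exact h.imp fun u hu _ => hu
    · exact ⟨(x, x), fun h' => absurd h' h⟩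
  choose φ hφ using hchoice
  obtain ⟨S, hCS, hS, hmaps⟩ := exists_countable_superset_mapsTo
    (fun (i : Bool × ℚ × ℚ) x => bif i.1 then (φ x i.2.1 i.2.2).1 else (φ x i.2.1 i.2.2).2) hC
  refine ⟨closure S, ⟨isClosed_closure, hS.isSeparable.closure⟩,
    capturesDiffQuotients_closure fun x hx q b h => ?_, hYC.trans (closure_mono hCS)⟩
  obtain ⟨⟨hne, h1, h2⟩, hu⟩ := hφ x q b h
  exact ⟨φ x q b, ⟨hne, ⟨hmaps (true, q, b) hx, h1⟩, ⟨hmaps (false, q, b) hx, h2⟩⟩, hu⟩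

theorem isRichFamily_capturesDiffQuotients {X : Type*} [MetricSpace X] (f : X → ℝ) :
    IsRichFamily {Y : Set X | (IsClosed Y ∧ IsSeparable Y) ∧ CapturesDiffQuotients f Y} := by
  refine ⟨fun Y hY => hY.1, fun Y₀ hY₀ => ?_, fun Y hY _ => ⟨⟨isClosed_closure, ?_⟩, ?_⟩⟩
  · obtain ⟨Y, hY, hcap, hsub⟩ := exists_separable_capturesDiffQuotients f hY₀
    exact ⟨Y, ⟨hY, hcap⟩, hsub⟩
  · exact (IsSeparable.iUnion fun n => (hY n).1.2).closure
  · refine capturesDiffQuotients_closure fun x hx q b h => ?_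
    obtain ⟨n, hn⟩ := mem_iUnion.1 hx
    exact ((hY n).2 x hn q b h).mono (inter_subset_inter_left _ (subset_iUnion Y n)) le_rfl

/-- Separable reducibility of local difference quotients (Proposition 3.2): there is a
rich family `R` of closed separable subsets of `X` such that for every `Y ∈ R`, every
`x ∈ Y` and every `r > 0`, the supremum (in the extended reals) of
`|f u₁ − f u₂| / d(u₁,u₂)` over pairs of distinct points of the open ball `B(x,r)`
equals the same supremum over pairs of distinct points of `Y ∩ B(x,r)`. -/
theorem separable_reduction_difference_quotients
    {X : Type*} [MetricSpace X] (f : X → ℝ) :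
    ∃ R : Set (Set X), IsRichFamily R ∧
      ∀ Y ∈ R, ∀ x ∈ Y, ∀ r : ℝ, 0 < r →
        (⨆ (u : X × X) (_ : u.1 ≠ u.2 ∧ u.1 ∈ ball x r ∧ u.2 ∈ ball x r),
            ((|f u.1 - f u.2| / dist u.1 u.2 : ℝ) : EReal)) =
          ⨆ (u : X × X) (_ : u.1 ≠ u.2 ∧ u.1 ∈ Y ∩ ball x r ∧ u.2 ∈ Y ∩ ball x r),
            ((|f u.1 - f u.2| / dist u.1 u.2 : ℝ) : EReal) := by
  refine ⟨_, isRichFamily_capturesDiffQuotients f, fun Y hY x hx r _ => le_antisymm ?_ ?_⟩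
  · refine iSup₂_le fun u hu => le_of_forall_lt fun c hc => ?_
    obtain ⟨a, hca, hau⟩ := EReal.lt_iff_exists_real_btwn.1 hc
    obtain ⟨v, hv, hav⟩ := hY.2 x hx r a ⟨u, hu, EReal.coe_lt_coe_iff.1 hau⟩
    exact (hca.trans (EReal.coe_lt_coe_iff.2 hav)).trans_le
      (le_iSup₂ (f := fun (u : X × X) (_ : u.1 ≠ u.2 ∧ u.1 ∈ Y ∩ ball x r ∧ u.2 ∈ Y ∩ ball x r) =>
        ((|f u.1 - f u.2| / dist u.1 u.2 : ℝ) : EReal)) v hv)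
  · exact biSup_mono fun u hu => ⟨hu.1, hu.2.1.2, hu.2.2.2⟩
end

section
/- Let (X₁,d₁) and (X₂,d₂) be metric spaces, endow X₁ × X₂ with a product metric, and let f : X₁ × X₂ → ℝ be a function that is Lipschitz in the second variable uniformly in the first: there is k > 0 such that |f(x,y′) − f(x,y″)| ≤ k·d₂(y′,y″) for every x ∈ X₁ and all y′, y″ ∈ X₂. Then there is a rich family 𝓡 of closed separable subsets of X₁ × X₂, each of the form Y₁ × Y₂ with Y₁ a closed separable subset of X₁ and Y₂ a closed separable subset of X₂, such that for every Y₁ × Y₂ ∈ 𝓡 and every (x,y) ∈ Y₁ × Y₂ the slope of the partial function f(·,y) at x computed in X₁ equals the slope of its restriction to Y₁ at x: |∇f(·,y)|(x) = |∇(f|_{Y₁×Y₂})(·,y)|(x). -/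
open Filter TopologicalSpace Set Metric
open scoped Topology

/-- The slope `|∇g|(x) = limsup_{u→x, u≠x} (g x − g u)⁺ / d(x,u)` of a real-valued
function, with the upper limit computed in the extended reals. -/
noncomputable def rslope {X : Type*} [MetricSpace X] (g : X → ℝ) (x : X) : EReal :=
  limsup (fun u => ((max (g x - g u) 0 / dist x u : ℝ) : EReal)) (𝓝[≠] x)

/-- The pair `(A, B)` is *closed under slopes* of `f` if, for `z ∈ A` and `w ∈ B`, the values
`(dist z u, f (u, w))` at arbitrary `u : X₁` are approximated by values at points `u ∈ A`. -/
def SlopeClosed {X₁ X₂ : Type*} [MetricSpace X₁] (f : X₁ × X₂ → ℝ)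
    (A : Set X₁) (B : Set X₂) : Prop :=
  ∀ z ∈ A, ∀ w ∈ B, range (fun u => (dist z u, f (u, w))) ⊆
    closure ((fun u => (dist z u, f (u, w))) '' A)

theorem SlopeClosed.closure {X₁ X₂ : Type*} [MetricSpace X₁] [MetricSpace X₂]
    {f : X₁ × X₂ → ℝ} {k : ℝ} (hk : 0 < k)
    (hLip : ∀ x : X₁, ∀ y' y'' : X₂, |f (x, y') - f (x, y'')| ≤ k * dist y' y'')
    {A : Set X₁} {B : Set X₂} (h : SlopeClosed f A B) :
    SlopeClosed f (closure A) (closure B) := by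
  rintro z hz w hw _ ⟨u, rfl⟩
  rw [Metric.mem_closure_iff]
  intro ε hε
  obtain ⟨z', hz', hzz'⟩ := Metric.mem_closure_iff.1 hz (ε / 3) (by positivity)
  obtain ⟨w', hw', hww'⟩ := Metric.mem_closure_iff.1 hw (ε / 3 / k) (by positivity)
  obtain ⟨_, ⟨v, hv, rfl⟩, huv⟩ :=
    Metric.mem_closure_iff.1 (h z' hz' w' hw' ⟨u, rfl⟩) (ε / 3) (by positivity)
  refine ⟨_, ⟨v, subset_closure hv, rfl⟩, ?_⟩
  have hkw : k * dist w w' < ε / 3 := by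
    rw [lt_div_iff₀ hk] at hww'
    linarith
  simp only [Prod.dist_eq, sup_lt_iff, Real.dist_eq, abs_lt] at huv ⊢
  have hu := abs_le.1 (hLip u w w')
  have hv := abs_le.1 (hLip v w w')
  have h₁ := dist_triangle z z' u
  have h₂ := dist_triangle z z' v
  have h₃ := dist_triangle_left z' u z
  have h₄ := dist_triangle_left z' v z
  refine ⟨⟨?_, ?_⟩, ?_, ?_⟩ <;> linarith [huv.1.1, huv.1.2, huv.2.1, huv.2.2]

theorem exists_countable_slopeClosed {X₁ X₂ : Type*} [MetricSpace X₁] (f : X₁ × X₂ → ℝ)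
    {A₀ : Set X₁} {B : Set X₂} (hA₀ : A₀.Countable) (hB : B.Countable) :
    ∃ A : Set X₁, A.Countable ∧ A₀ ⊆ A ∧ SlopeClosed f A B := by
  have key : ∀ (z : X₁) (w : X₂), ∃ C : Set X₁, C.Countable ∧
      range (fun u => (dist z u, f (u, w))) ⊆
        closure ((fun u => (dist z u, f (u, w))) '' C) := by
    intro z w
    obtain ⟨c, hcs, hc, hcl⟩ := (IsSeparable.of_separableSpace
      (range (fun u => (dist z u, f (u, w))))).exists_countable_dense_subset
    obtain ⟨C, rfl, hinj⟩ := exists_image_eq_injOn_of_subset_range hcs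
    exact ⟨C, countable_of_injective_of_countable_image hinj hc, hcl⟩
  choose C hC hCd using key
  let A : ℕ → Set X₁ := fun n =>
    Nat.rec A₀ (fun _ S => S ∪ ⋃ z ∈ S, ⋃ w ∈ B, C z w) n
  have hsucc : ∀ n, A (n + 1) = A n ∪ ⋃ z ∈ A n, ⋃ w ∈ B, C z w := fun _ => rfl
  have hA : ∀ n, (A n).Countable := by
    intro n
    induction n with
    | zero => exact hA₀
    | succ n ih =>
      rw [hsucc]
      exact ih.union (ih.biUnion fun z _ => hB.biUnion fun w _ => hC z w)
  refine ⟨⋃ n, A n, countable_iUnion hA, subset_iUnion A 0, ?_⟩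
  intro z hz w hw
  obtain ⟨n, hn⟩ := mem_iUnion.1 hz
  refine (hCd z w).trans (closure_mono (image_mono ?_))
  refine Subset.trans ?_ (subset_iUnion A (n + 1))
  rw [hsucc]
  refine Subset.trans ?_ subset_union_right
  exact fun v hv => mem_biUnion hn (mem_biUnion hw hv)

theorem rslope_restrict_le {X : Type*} [MetricSpace X] (g : X → ℝ) {Y : Set X} (x : Y) :
    rslope (fun u : Y => g u) x ≤ rslope g x := by
  have hmap : map Subtype.val (𝓝[≠] x) ≤ 𝓝[≠] (x : X) :=
    tendsto_nhdsWithin_of_tendsto_nhds_of_eventually_within _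
      (continuous_subtype_val.continuousAt.tendsto.mono_left nhdsWithin_le_nhds)
      (eventually_mem_nhdsWithin.mono fun u hu h => hu (Subtype.ext h))
  exact limsup_le_limsup_of_le (u := fun u : X =>
    ((max (g x - g u) 0 / dist (x : X) u : ℝ) : EReal)) hmap

theorem rslope_le_restrict {X : Type*} [MetricSpace X] (g : X → ℝ) {Y : Set X} (x : Y)
    (h : range (fun u => (dist (x : X) u, g u)) ⊆
      closure ((fun u => (dist (x : X) u, g u)) '' Y)) :
    rslope g x ≤ rslope (fun u : Y => g u) x := by
  refine le_of_forall_lt_imp_le_of_dense fun c hc => ?_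
  refine le_limsup_of_frequently_le ?_
  have hfreq := frequently_lt_of_lt_limsup (by isBoundedDefault) hc
  rw [(nhdsWithin_hasBasis nhds_basis_ball _).frequently_iff] at hfreq ⊢
  intro ε hε
  obtain ⟨u, ⟨huε, hux⟩, hcu⟩ := hfreq ε hε
  have hpos : 0 < dist (x : X) u := dist_pos.2 (Ne.symm hux)
  have hcont : ContinuousAt
      (fun p : ℝ × ℝ => ((max (g x - p.2) 0 / p.1 : ℝ) : EReal)) (dist (x : X) u, g u) := by
    refine continuous_coe_real_ereal.continuousAt.comp ?_
    exact ContinuousAt.div (by fun_prop) (by fun_prop) hpos.ne'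
  have hlt : dist (x : X) u < ε := by rwa [dist_comm]
  have hev : ∀ᶠ p : ℝ × ℝ in 𝓝 (dist (x : X) u, g u),
      c < ((max (g x - p.2) 0 / p.1 : ℝ) : EReal) ∧ 0 < p.1 ∧ p.1 < ε :=
    (hcont.eventually (lt_mem_nhds hcu)).and
      ((continuous_fst.continuousAt.eventually (lt_mem_nhds hpos)).and
        (continuous_fst.continuousAt.eventually (gt_mem_nhds hlt)))
  obtain ⟨_, ⟨hcv, hv₀, hvε⟩, v, hv, rfl⟩ :=
    mem_closure_iff_nhds.1 (h ⟨u, rfl⟩) _ hev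
  refine ⟨⟨v, hv⟩, ⟨?_, ?_⟩, hcv.le⟩
  · rw [mem_ball, dist_comm]
    exact hvε
  · rintro rfl
    simp at hv₀

theorem SlopeClosed.prod_image_iUnion {X₁ X₂ : Type*} [MetricSpace X₁]
    {f : X₁ × X₂ → ℝ} {Y : ℕ → Set (X₁ × X₂)} (hmono : Monotone Y)
    (hY : ∀ n, ∃ A B, SlopeClosed f A B ∧ Y n = A ×ˢ B) :
    SlopeClosed f (Prod.fst '' ⋃ n, Y n) (Prod.snd '' ⋃ n, Y n) ∧
      ⋃ n, Y n = (Prod.fst '' ⋃ n, Y n) ×ˢ (Prod.snd '' ⋃ n, Y n) := by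
  have key : ∀ z ∈ Prod.fst '' ⋃ n, Y n, ∀ w ∈ Prod.snd '' ⋃ n, Y n, ∃ n, (z, w) ∈ Y n := by
    rintro _ ⟨⟨z, b⟩, hz, rfl⟩ _ ⟨⟨a, w⟩, hw, rfl⟩
    obtain ⟨n, hn⟩ := mem_iUnion.1 hz
    obtain ⟨m, hm⟩ := mem_iUnion.1 hw
    have hn' := hmono (le_max_left n m) hn
    have hm' := hmono (le_max_right n m) hm
    refine ⟨max n m, ?_⟩
    obtain ⟨A, B, -, hAB⟩ := hY (max n m)
    rw [hAB] at hn' hm' ⊢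
    exact ⟨hn'.1, hm'.2⟩
  constructor
  · intro z hz w hw
    obtain ⟨n, hn⟩ := key z hz w hw
    obtain ⟨A, B, hAB, hYn⟩ := hY n
    rw [hYn] at hn
    refine (hAB z hn.1 w hn.2).trans (closure_mono (image_mono fun v hv => ?_))
    refine ⟨(v, w), mem_iUnion.2 ⟨n, ?_⟩, rfl⟩
    rw [hYn]
    exact ⟨hv, hn.2⟩
  · refine Subset.antisymm (fun p hp => ⟨mem_image_of_mem _ hp, mem_image_of_mem _ hp⟩) ?_
    rintro ⟨z, w⟩ ⟨hz, hw⟩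
    exact mem_iUnion.2 (key z hz w hw)

/-- Theorem 4.3: if `f : X₁ × X₂ → ℝ` is Lipschitz in the second variable uniformly in
the first, then there is a rich family of closed separable subsets of `X₁ × X₂`, each
a product `Y₁ ×ˢ Y₂` of closed separable subsets, such that for every member `Y₁ ×ˢ Y₂`
and every `(x,y) ∈ Y₁ ×ˢ Y₂`, the slope of `f(·,y)` at `x` computed in `X₁` equals the
slope of its restriction to `Y₁` at `x`, computed in the metric space `Y₁`. -/
theorem separable_reduction_partial_slope
    {X₁ X₂ : Type*} [MetricSpace X₁] [MetricSpace X₂]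
    (f : X₁ × X₂ → ℝ) (k : ℝ) (hk : 0 < k)
    (hLip : ∀ x : X₁, ∀ y' y'' : X₂, |f (x, y') - f (x, y'')| ≤ k * dist y' y'') :
    ∃ R : Set (Set (X₁ × X₂)), IsRichFamily R ∧
      ∀ Y ∈ R, ∃ Y₁ : Set X₁, ∃ Y₂ : Set X₂,
        IsClosed Y₁ ∧ TopologicalSpace.IsSeparable Y₁ ∧
        IsClosed Y₂ ∧ TopologicalSpace.IsSeparable Y₂ ∧
        Y = Y₁ ×ˢ Y₂ ∧
        ∀ x : X₁, ∀ hx : x ∈ Y₁, ∀ y ∈ Y₂,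
          rslope (fun u : X₁ => f (u, y)) x =
            rslope (fun u : Y₁ => f (u, y)) ⟨x, hx⟩ := by
  refine ⟨{Y | ∃ (Y₁ : Set X₁) (Y₂ : Set X₂), IsClosed Y₁ ∧ IsSeparable Y₁ ∧
    IsClosed Y₂ ∧ IsSeparable Y₂ ∧ Y = Y₁ ×ˢ Y₂ ∧ SlopeClosed f Y₁ Y₂}, ⟨?_, ?_, ?_⟩, ?_⟩
  · rintro _ ⟨Y₁, Y₂, hc₁, hs₁, hc₂, hs₂, rfl, -⟩
    exact ⟨hc₁.prod hc₂, hs₁.prod hs₂⟩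
  · rintro Y₀ ⟨c, hc, hY₀⟩
    obtain ⟨A, hA, hcA, hAB⟩ :=
      exists_countable_slopeClosed f (hc.image Prod.fst) (hc.image Prod.snd)
    refine ⟨_, ⟨closure A, closure (Prod.snd '' c), isClosed_closure, hA.isSeparable.closure,
      isClosed_closure, (hc.image _).isSeparable.closure, rfl, hAB.closure hk hLip⟩, ?_⟩
    rw [← closure_prod_eq]
    exact hY₀.trans (closure_mono fun p hp =>
      ⟨hcA (mem_image_of_mem _ hp), mem_image_of_mem _ hp⟩)
  · intro Y hY hstep
    have hsep : IsSeparable (⋃ n, Y n) := by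
      refine IsSeparable.iUnion fun n => ?_
      obtain ⟨Y₁, Y₂, -, hs₁, -, hs₂, hYn, -⟩ := hY n
      rw [hYn]
      exact hs₁.prod hs₂
    obtain ⟨hAB, hprod⟩ := SlopeClosed.prod_image_iUnion (f := f)
      (monotone_nat_of_le_succ hstep) fun n => by
        obtain ⟨Y₁, Y₂, -, -, -, -, hYn, hYY⟩ := hY n
        exact ⟨Y₁, Y₂, hYY, hYn⟩
    refine ⟨_, _, isClosed_closure, (hsep.image continuous_fst).closure, isClosed_closure,
      (hsep.image continuous_snd).closure, ?_, hAB.closure hk hLip⟩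
    rw [← closure_prod_eq, ← hprod]
  · rintro _ ⟨Y₁, Y₂, hc₁, hs₁, hc₂, hs₂, rfl, hYY⟩
    refine ⟨Y₁, Y₂, hc₁, hs₁, hc₂, hs₂, rfl, fun x hx y hy => le_antisymm ?_ ?_⟩
    · exact rslope_le_restrict (fun u => f (u, y)) ⟨x, hx⟩ (hYY x hx y hy)
    · exact rslope_restrict_le (fun u => f (u, y)) ⟨x, hx⟩
end
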